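/- Let Assumption A hold. For β ∈ ℝ and i ∈ {1,2} define vector fields on ℝ⁴ by C_i^{0,β} = F_i, C_i^{1,β} = [F0 + β F2, C_i^{0,β}], C_i^{2,β} = [F0 + β F2, C_i^{1,β}]. Then for every β > 0 there exist β* with 0 < β* ≤ β and ᾱ > 0 such that for every z = (x,y,θ,α) ∈ ℝ⁴ with 0 < |α| < ᾱ, the six vectors C_1^{0,β*}(z), C_2^{0,β*}(z), C_1^{1,β*}(z), C_2^{1,β*}(z), C_1^{2,β*}(z), C_2^{2,β*}(z) span ℝ⁴. -/

import Mathlib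

open Real Matrix Set

/-- The 4×4 matrix E(α) of the two-link magneto-elastic swimmer,
with blocks E11, E12, E21, E22 as in the paper. -/
noncomputable def Emat (l1 l2 x1 x2 e1 e2 a : ℝ) : Matrix (Fin 4) (Fin 4) ℝ :=
  !![ -(x1*l1 + x2*l2) * Real.cos a, -(x1*l1 + e2*l2) * Real.sin a,
        (1/2)*x1*l1*l2*Real.sin a, 0;
      (e1*l1 + x2*l2) * Real.sin a, -(e1*l1 + e2*l2) * Real.cos a,
        (1/2)*e1*l1*(l1 + l2*Real.cos a), (1/2)*e1*l1^2;
      (1/2)*(e1*l1^2*(-Real.sin a)), (1/2)*(e1*l1^2*Real.cos a - e2*l2^2),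
        -(e1*l1^2*((1/4)*l2*Real.cos a + (1/3)*l1) + e2*l2^2*((1/12)*l2)),
        -(e1*l1^2*((1/3)*l1));
      0, (1/2)*(-(e2*l2^2)), -(e2*l2^2*((1/12)*l2)), 0]

/-- R̃(θ) = diag(R_θ, I₂). -/
noncomputable def Rtil (th : ℝ) : Matrix (Fin 4) (Fin 4) ℝ :=
  !![Real.cos th, -Real.sin th, 0, 0;
     Real.sin th,  Real.cos th, 0, 0;
     0, 0, 1, 0;
     0, 0, 0, 1]

/-- X3(z) = R̃(θ)·(third column of E(α)⁻¹), where z = (x,y,θ,α). -/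
noncomputable def X3 (l1 l2 x1 x2 e1 e2 : ℝ) (z : Fin 4 → ℝ) : Fin 4 → ℝ :=
  (Rtil (z 2)).mulVec fun i => (Emat l1 l2 x1 x2 e1 e2 (z 3))⁻¹ i 2

/-- X4(z) = R̃(θ)·(fourth column of E(α)⁻¹), where z = (x,y,θ,α). -/
noncomputable def X4 (l1 l2 x1 x2 e1 e2 : ℝ) (z : Fin 4 → ℝ) : Fin 4 → ℝ :=
  (Rtil (z 2)).mulVec fun i => (Emat l1 l2 x1 x2 e1 e2 (z 3))⁻¹ i 3

/-- F0(z) = κ α X4(z). -/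
noncomputable def F0 (l1 l2 x1 x2 e1 e2 k : ℝ) (z : Fin 4 → ℝ) : Fin 4 → ℝ :=
  (k * z 3) • X4 l1 l2 x1 x2 e1 e2 z

/-- F1(z) = M1 sin α · X3(z). -/
noncomputable def F1 (l1 l2 x1 x2 e1 e2 M1 : ℝ) (z : Fin 4 → ℝ) : Fin 4 → ℝ :=
  (M1 * Real.sin (z 3)) • X3 l1 l2 x1 x2 e1 e2 z

/-- F2(z) = −(M1 cos α + M2) X3(z) − M2 X4(z). -/
noncomputable def F2 (l1 l2 x1 x2 e1 e2 M1 M2 : ℝ) (z : Fin 4 → ℝ) : Fin 4 → ℝ :=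
  (-(M1 * Real.cos (z 3) + M2)) • X3 l1 l2 x1 x2 e1 e2 z
    - M2 • X4 l1 l2 x1 x2 e1 e2 z

/-- Lie bracket of two vector fields on ℝ⁴: [X,Y](z) = DY(z)·X(z) − DX(z)·Y(z). -/
noncomputable def lieBr (X Y : (Fin 4 → ℝ) → (Fin 4 → ℝ)) (z : Fin 4 → ℝ) : Fin 4 → ℝ :=
  fderiv ℝ Y z (X z) - fderiv ℝ X z (Y z)

/-- The origin O = (0,0,0,0). -/
def Ovec : Fin 4 → ℝ := ![0, 0, 0, 0]

/-- Assumption A of the paper. -/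
def AssumptionA (l1 l2 x1 x2 e1 e2 M1 M2 : ℝ) : Prop :=
  ((e1 - x1, e2 - x2) ≠ (0, 0)) ∧ x1 ≤ e1 ∧ x2 ≤ e2 ∧ M1 ≠ 0 ∧ M2 ≠ 0 ∧
    (3 + 4*(l2/l1) + e2*l2^2/(e1*l1^2)) * M1
      - (3 + 4*(l1/l2) + e1*l1^2/(e2*l2^2)) * M2 ≠ 0


/-- The infinitesimal generator of `Rtil`. -/
def rotGen (v : Fin 4 → ℝ) : Fin 4 → ℝ := ![-v 1, v 0, 0, 0]

/-- The vector field whose expression in the frame attached to the swimmer is `u`. -/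
noncomputable def bodyLift (u : ℝ → Fin 4 → ℝ) (z : Fin 4 → ℝ) : Fin 4 → ℝ :=
  (Rtil (z 2)).mulVec (u (z 3))

/-- The Lie bracket expressed in the frame attached to the swimmer. -/
noncomputable def bodyBr (u v : ℝ → Fin 4 → ℝ) (a : ℝ) : Fin 4 → ℝ :=
  u a 2 • rotGen (v a) + u a 3 • deriv v a - (v a 2 • rotGen (u a) + v a 3 • deriv u a)

theorem differentiableAt_and_fderiv_bodyLift {u : ℝ → Fin 4 → ℝ} {z : Fin 4 → ℝ}
    (hu : DifferentiableAt ℝ u (z 3)) :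
    DifferentiableAt ℝ (bodyLift u) z ∧ ∀ d, fderiv ℝ (bodyLift u) z d =
      (Rtil (z 2)).mulVec (d 2 • rotGen (u (z 3)) + d 3 • deriv u (z 3)) := by
  have hp : ∀ i : Fin 4, HasFDerivAt (fun w : Fin 4 → ℝ => w i)
      (ContinuousLinearMap.proj i : (Fin 4 → ℝ) →L[ℝ] ℝ) z := fun i => hasFDerivAt_apply i z
  have hc := (Real.hasDerivAt_cos (z 2)).comp_hasFDerivAt z (hp 2)
  have hs := (Real.hasDerivAt_sin (z 2)).comp_hasFDerivAt z (hp 2)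
  have hui : ∀ i, HasFDerivAt (fun w : Fin 4 → ℝ => u (w 3) i)
      (deriv u (z 3) i • (ContinuousLinearMap.proj 3 : (Fin 4 → ℝ) →L[ℝ] ℝ)) z := fun i => by
    have h : HasDerivAt (fun t => u t i) (deriv u (z 3) i) ((fun w : Fin 4 → ℝ => w 3) z) :=
      hasDerivAt_pi.1 hu.hasDerivAt i
    exact h.comp_hasFDerivAt z (hp 3)
  have h : HasFDerivAt (bodyLift u) (ContinuousLinearMap.pi
      (![Real.cos (z 2) • (deriv u (z 3) 0 • ContinuousLinearMap.proj 3)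
          + u (z 3) 0 • (-Real.sin (z 2) • ContinuousLinearMap.proj 2)
          - (Real.sin (z 2) • (deriv u (z 3) 1 • ContinuousLinearMap.proj 3)
          + u (z 3) 1 • (Real.cos (z 2) • ContinuousLinearMap.proj 2)),
        Real.sin (z 2) • (deriv u (z 3) 0 • ContinuousLinearMap.proj 3)
          + u (z 3) 0 • (Real.cos (z 2) • ContinuousLinearMap.proj 2)
          + (Real.cos (z 2) • (deriv u (z 3) 1 • ContinuousLinearMap.proj 3)
          + u (z 3) 1 • (-Real.sin (z 2) • ContinuousLinearMap.proj 2)),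
        deriv u (z 3) 2 • ContinuousLinearMap.proj 3,
        deriv u (z 3) 3 • ContinuousLinearMap.proj 3] :
          Fin 4 → (Fin 4 → ℝ) →L[ℝ] ℝ)) z := by
    rw [hasFDerivAt_pi']
    intro i
    fin_cases i
    · refine ((hc.mul (hui 0)).sub (hs.mul (hui 1))).congr_of_eventuallyEq
        (Filter.Eventually.of_forall fun w => ?_)
      simp [bodyLift, Rtil, Matrix.mulVec, dotProduct, Fin.sum_univ_four, sub_eq_add_neg]
    · refine ((hs.mul (hui 0)).add (hc.mul (hui 1))).congr_of_eventuallyEq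
        (Filter.Eventually.of_forall fun w => ?_)
      simp [bodyLift, Rtil, Matrix.mulVec, dotProduct, Fin.sum_univ_four]
    · refine (hui 2).congr_of_eventuallyEq (Filter.Eventually.of_forall fun w => ?_)
      simp [bodyLift, Rtil, Matrix.mulVec, dotProduct, Fin.sum_univ_four]
    · refine (hui 3).congr_of_eventuallyEq (Filter.Eventually.of_forall fun w => ?_)
      simp [bodyLift, Rtil, Matrix.mulVec, dotProduct, Fin.sum_univ_four]
  refine ⟨h.differentiableAt, fun d => ?_⟩
  rw [h.fderiv]
  ext i
  fin_cases i <;>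
    simp [rotGen, Rtil, Matrix.mulVec, dotProduct, Fin.sum_univ_four] <;> ring

theorem bodyLift_two (u : ℝ → Fin 4 → ℝ) (z : Fin 4 → ℝ) : bodyLift u z 2 = u (z 3) 2 := by
  simp [bodyLift, Rtil, Matrix.mulVec, dotProduct, Fin.sum_univ_four]

theorem bodyLift_three (u : ℝ → Fin 4 → ℝ) (z : Fin 4 → ℝ) : bodyLift u z 3 = u (z 3) 3 := by
  simp [bodyLift, Rtil, Matrix.mulVec, dotProduct, Fin.sum_univ_four]

theorem lieBr_bodyLift {u v : ℝ → Fin 4 → ℝ} {z : Fin 4 → ℝ}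
    (hu : DifferentiableAt ℝ u (z 3)) (hv : DifferentiableAt ℝ v (z 3)) :
    lieBr (bodyLift u) (bodyLift v) z = bodyLift (bodyBr u v) z := by
  rw [lieBr, (differentiableAt_and_fderiv_bodyLift hu).2, (differentiableAt_and_fderiv_bodyLift hv).2, ← Matrix.mulVec_sub,
    bodyLift_two, bodyLift_two, bodyLift_three, bodyLift_three]
  rfl

theorem lieBr_congr_right {X Y Y' : (Fin 4 → ℝ) → Fin 4 → ℝ} {z : Fin 4 → ℝ}
    (h : Y =ᶠ[nhds z] Y') : lieBr X Y z = lieBr X Y' z := by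
  rw [lieBr, lieBr, h.fderiv_eq, h.eq_of_nhds]

theorem rotGen_add (v w : Fin 4 → ℝ) : rotGen (v + w) = rotGen v + rotGen w := by
  ext i; fin_cases i <;> simp [rotGen, add_comm]

theorem rotGen_smul (c : ℝ) (v : Fin 4 → ℝ) : rotGen (c • v) = c • rotGen v := by
  ext i; fin_cases i <;> simp [rotGen]

theorem bodyBr_comm (u v : ℝ → Fin 4 → ℝ) (a : ℝ) : bodyBr u v a = -bodyBr v u a := by
  rw [bodyBr, bodyBr, neg_sub]

theorem bodyBr_self (u : ℝ → Fin 4 → ℝ) (a : ℝ) : bodyBr u u a = 0 := sub_self _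

theorem bodyBr_add_right (u : ℝ → Fin 4 → ℝ) {v w : ℝ → Fin 4 → ℝ} {a : ℝ}
    (hv : DifferentiableAt ℝ v a) (hw : DifferentiableAt ℝ w a) :
    bodyBr u (v + w) a = bodyBr u v a + bodyBr u w a := by
  simp only [bodyBr, deriv_add hv hw, Pi.add_apply, rotGen_add]
  module

theorem bodyBr_smul_right (u : ℝ → Fin 4 → ℝ) {f : ℝ → ℝ} {v : ℝ → Fin 4 → ℝ} {a : ℝ}
    (hf : DifferentiableAt ℝ f a) (hv : DifferentiableAt ℝ v a) :
    bodyBr u (f • v) a = f a • bodyBr u v a + (u a 3 * deriv f a) • v a := by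
  have h : deriv (f • v) a = f a • deriv v a + deriv f a • v a := deriv_smul hf hv
  simp only [bodyBr, h, Pi.smul_apply, Pi.smul_apply', rotGen_smul, smul_eq_mul]
  module

theorem analyticAt_bodyBr {u v : ℝ → Fin 4 → ℝ} {a : ℝ}
    (hu : AnalyticAt ℝ u a) (hv : AnalyticAt ℝ v a) : AnalyticAt ℝ (bodyBr u v) a := by
  have hrot : ∀ {w : ℝ → Fin 4 → ℝ}, AnalyticAt ℝ w a →
      AnalyticAt ℝ (fun t => rotGen (w t)) a := fun {w} hw => by
    have hw' := analyticAt_pi_iff.1 hw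
    refine analyticAt_pi_iff.2 fun i => ?_
    fin_cases i
    · exact (hw' 1).neg
    · exact hw' 0
    · exact analyticAt_const
    · exact analyticAt_const
  have hu' := analyticAt_pi_iff.1 hu
  have hv' := analyticAt_pi_iff.1 hv
  exact (((hu' 2).smul (hrot hv)).add ((hu' 3).smul hv.deriv)).sub
    (((hv' 2).smul (hrot hu)).add ((hv' 3).smul hu.deriv))

theorem analyticAt_det {n : ℕ} {A : ℝ → Matrix (Fin n) (Fin n) ℝ} {a : ℝ}
    (hA : ∀ i j, AnalyticAt ℝ (fun t => A t i j) a) : AnalyticAt ℝ (fun t => (A t).det) a := by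
  simp only [Matrix.det_apply']
  exact Finset.analyticAt_fun_sum _ fun σ _ =>
    analyticAt_const.mul (Finset.analyticAt_fun_prod _ fun i _ => hA _ _)

theorem analyticAt_inv_apply {n : ℕ} {A : ℝ → Matrix (Fin n) (Fin n) ℝ} {a : ℝ}
    (hA : ∀ i j, AnalyticAt ℝ (fun t => A t i j) a) (h : (A a).det ≠ 0) (i j : Fin n) :
    AnalyticAt ℝ (fun t => (A t)⁻¹ i j) a := by
  simp only [Matrix.inv_def, Matrix.smul_apply, Matrix.adjugate_apply, Ring.inverse_eq_inv',
    smul_eq_mul]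
  refine ((analyticAt_det hA).inv h).mul (analyticAt_det fun k l => ?_)
  simp only [Matrix.updateRow_apply]
  split_ifs
  · exact analyticAt_const
  · exact hA k l

/-- The coefficient of `sin a` in `Emat`. -/
noncomputable def EmatSin (l1 l2 x1 x2 e1 e2 : ℝ) : Matrix (Fin 4) (Fin 4) ℝ :=
  !![0, -(x1*l1 + e2*l2), (1/2)*x1*l1*l2, 0;
     e1*l1 + x2*l2, 0, 0, 0;
     -(1/2)*e1*l1^2, 0, 0, 0;
     0, 0, 0, 0]

/-- The coefficient of `cos a` in `Emat`. -/
noncomputable def EmatCos (l1 l2 x1 x2 e1 e2 : ℝ) : Matrix (Fin 4) (Fin 4) ℝ :=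
  !![-(x1*l1 + x2*l2), 0, 0, 0;
     0, -(e1*l1 + e2*l2), (1/2)*e1*l1*l2, 0;
     0, (1/2)*e1*l1^2, -(1/4)*e1*l1^2*l2, 0;
     0, 0, 0, 0]

theorem Emat_eq (l1 l2 x1 x2 e1 e2 a : ℝ) (i j : Fin 4) :
    Emat l1 l2 x1 x2 e1 e2 a i j =
      (Emat l1 l2 x1 x2 e1 e2 0 - EmatCos l1 l2 x1 x2 e1 e2) i j
        + EmatCos l1 l2 x1 x2 e1 e2 i j * Real.cos a
        + EmatSin l1 l2 x1 x2 e1 e2 i j * Real.sin a := by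
  fin_cases i <;> fin_cases j <;> simp [Emat, EmatCos, EmatSin] <;> ring

theorem analyticAt_Emat (l1 l2 x1 x2 e1 e2 a : ℝ) (i j : Fin 4) :
    AnalyticAt ℝ (fun t => Emat l1 l2 x1 x2 e1 e2 t i j) a := by
  simp only [Emat_eq]
  exact (analyticAt_const.add (analyticAt_const.mul Real.analyticAt_cos)).add
    (analyticAt_const.mul Real.analyticAt_sin)

theorem hasDerivAt_Emat_zero (l1 l2 x1 x2 e1 e2 : ℝ) (i j : Fin 4) :
    HasDerivAt (fun t => Emat l1 l2 x1 x2 e1 e2 t i j) (EmatSin l1 l2 x1 x2 e1 e2 i j) 0 := by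
  simp only [fun t => Emat_eq l1 l2 x1 x2 e1 e2 t i j]
  have h := (((Real.hasDerivAt_cos 0).const_mul (EmatCos l1 l2 x1 x2 e1 e2 i j)).const_add
    ((Emat l1 l2 x1 x2 e1 e2 0 - EmatCos l1 l2 x1 x2 e1 e2) i j)).fun_add
    ((Real.hasDerivAt_sin 0).const_mul (EmatSin l1 l2 x1 x2 e1 e2 i j))
  simpa using h

theorem det_Emat_zero (l1 l2 x1 x2 e1 e2 : ℝ) :
    (Emat l1 l2 x1 x2 e1 e2 0).det =
      -((x1*l1 + x2*l2) * (e1*l1 + e2*l2) * (e1*l1) * (e2*l2) * l1 * l2) * (l1 * l2) / 36 := by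
  simp [Emat, Matrix.det_succ_row_zero, Fin.sum_univ_succ, Fin.succAbove, Matrix.submatrix]
  ring

section Columns

variable {l1 l2 x1 x2 e1 e2 : ℝ}

theorem Emat_mulVec_deriv_zero {w : ℝ → Fin 4 → ℝ} {c : Fin 4 → ℝ}
    (hw : DifferentiableAt ℝ w 0)
    (hE : ∀ᶠ t in nhds 0, (Emat l1 l2 x1 x2 e1 e2 t).mulVec (w t) = c) :
    (Emat l1 l2 x1 x2 e1 e2 0).mulVec (deriv w 0)
      = -(EmatSin l1 l2 x1 x2 e1 e2).mulVec (w 0) := by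
  ext i
  have h1 : HasDerivAt (fun t => (Emat l1 l2 x1 x2 e1 e2 t).mulVec (w t) i)
      (∑ j, (EmatSin l1 l2 x1 x2 e1 e2 i j * w 0 j
        + Emat l1 l2 x1 x2 e1 e2 0 i j * deriv w 0 j)) 0 :=
    HasDerivAt.fun_sum (u := Finset.univ) fun j _ =>
      (hasDerivAt_Emat_zero l1 l2 x1 x2 e1 e2 i j).fun_mul (hasDerivAt_pi.1 hw.hasDerivAt j)
  have h2 : HasDerivAt (fun t => (Emat l1 l2 x1 x2 e1 e2 t).mulVec (w t) i) 0 0 :=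
    (hasDerivAt_const (0 : ℝ) (c i)).congr_of_eventuallyEq (hE.mono fun t ht => congrFun ht i)
  have h := h1.unique h2
  rw [Finset.sum_add_distrib] at h
  simp only [Matrix.mulVec, dotProduct, Pi.neg_apply]
  linarith

theorem deriv_eq_of_Emat_mulVec_eq (hx : x1*l1 + x2*l2 ≠ 0)
    (hdet : (Emat l1 l2 x1 x2 e1 e2 0).det ≠ 0) {w : ℝ → Fin 4 → ℝ} {c : Fin 4 → ℝ}
    (hc : c 0 = 0) (hw : DifferentiableAt ℝ w 0)
    (hE : ∀ᶠ t in nhds 0, (Emat l1 l2 x1 x2 e1 e2 t).mulVec (w t) = c) :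
    w 0 0 = 0 ∧ deriv w 0 =
      ![(-(x1*l1 + e2*l2) * w 0 1 + (1/2)*x1*l1*l2 * w 0 2) / (x1*l1 + x2*l2), 0, 0, 0] := by
  have h0 := congrFun hE.self_of_nhds 0
  have hw0 : w 0 0 = 0 := by
    simp [Emat, Matrix.mulVec, dotProduct, Fin.sum_univ_four, hc] at h0
    rcases h0 with h0 | h0
    · exact absurd (by linarith) hx
    · exact h0
  refine ⟨hw0, ?_⟩
  rw [← sub_eq_zero]
  apply Matrix.eq_zero_of_mulVec_eq_zero hdet
  rw [Matrix.mulVec_sub, Emat_mulVec_deriv_zero hw hE]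
  ext i
  fin_cases i <;>
    simp [Emat, EmatSin, dotProduct, Fin.sum_univ_four, hw0]
  linear_combination div_mul_cancel₀
    (-(x1*l1 + e2*l2) * w 0 1 + (1/2)*x1*l1*l2 * w 0 2) hx

theorem frame_nondegenerate (hl1 : 0 < l1) (hl2 : 0 < l2) (hx1 : 0 < x1) (hx2 : 0 < x2)
    (he1 : 0 < e1) (he2 : 0 < e2) (hne : (e1 - x1, e2 - x2) ≠ (0, 0)) (h1 : x1 ≤ e1)
    (h2 : x2 ≤ e2) {u v : ℝ → Fin 4 → ℝ} (hu : DifferentiableAt ℝ u 0)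
    (hv : DifferentiableAt ℝ v 0)
    (hEu : ∀ᶠ t in nhds 0, (Emat l1 l2 x1 x2 e1 e2 t).mulVec (u t) = ![0, 0, 1, 0])
    (hEv : ∀ᶠ t in nhds 0, (Emat l1 l2 x1 x2 e1 e2 t).mulVec (v t) = ![0, 0, 0, 1]) :
    u 0 2 * v 0 3 - v 0 2 * u 0 3 ≠ 0 ∧ ∃ P, P ≠ 0 ∧ bodyBr u v 0 = ![P, 0, 0, 0] := by
  have hx : 0 < x1*l1 + x2*l2 := by positivity
  have hy : 0 < e1*l1 + e2*l2 := by positivity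
  have hdet : (Emat l1 l2 x1 x2 e1 e2 0).det ≠ 0 := by
    rw [det_Emat_zero, neg_mul, neg_div]
    exact neg_ne_zero.2 (by positivity)
  obtain ⟨hu0, hu'⟩ := deriv_eq_of_Emat_mulVec_eq hx.ne' hdet rfl hu hEu
  obtain ⟨hv0, hv'⟩ := deriv_eq_of_Emat_mulVec_eq hx.ne' hdet rfl hv hEv
  have hu1 := congrFun hEu.self_of_nhds 1
  have hu2 := congrFun hEu.self_of_nhds 2
  have hu3 := congrFun hEu.self_of_nhds 3
  have hv1 := congrFun hEv.self_of_nhds 1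
  have hv2 := congrFun hEv.self_of_nhds 2
  have hv3 := congrFun hEv.self_of_nhds 3
  simp [Emat, Matrix.mulVec, dotProduct, Fin.sum_univ_four] at hu1 hu2 hu3 hv1 hv2 hv3
  set y := u 0 1
  set t := u 0 2
  set s := u 0 3
  set y' := v 0 1
  set t' := v 0 2
  set s' := v 0 3
  have hyt : (e1*l1 + e2*l2) * (y * t' - y' * t) = -(1/2) * e1 * l1^2 * (t * s' - t' * s) := by
    linear_combination -t' * hu1 + t * hv1
  have hys : (e1*l1 + e2*l2) * (y * s' - y' * s)
      = (1/2) * e1 * l1 * (l1 + l2) * (t * s' - t' * s) := by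
    linear_combination -s' * hu1 + s * hv1
  have hm : t * s' - t' * s ≠ 0 := by
    intro h0
    rw [h0, mul_zero] at hyt hys
    have hyt := (mul_eq_zero.1 hyt).resolve_left hy.ne'
    have hys := (mul_eq_zero.1 hys).resolve_left hy.ne'
    have h : (1 : ℝ) = 0 := by
      linear_combination
        ((1/2) * (e1*l1^2 - e2*l2^2) * (-(e2*l2^2*(l2/12)))
          - (e2*l2^2*(l2/12) + e1*l1^2*(l2/4 + l1/3)) * ((1/2)*e2*l2^2)) * hyt
        - (e1*l1^3/3) * ((1/2)*e2*l2^2) * hys - (e1*l1^3/3) * (e2*l2^3/12) * h0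
        - (hu2 * (-(1/2)*e2*l2^2*y' - e2*l2^3/12*t') + hv3
          - hu3 * ((1/2) * (e1*l1^2 - e2*l2^2) * y'
            - (e2*l2^3/12 + e1*l1^2*(l2/4 + l1/3)) * t' - e1*l1^3/3*s'))
    exact one_ne_zero h
  refine ⟨hm, (t * s' - t' * s) * (l1^2*l2 * (e1*(e2 - x2)) + l1*l2^2 * (e2*(e1 - x1)))
      / (2 * (x1*l1 + x2*l2) * (e1*l1 + e2*l2)), ?_, ?_⟩
  · refine div_ne_zero (mul_ne_zero hm ?_) (by positivity)
    rcases h1.lt_or_eq with h1 | h1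
    · have := mul_pos (by positivity : 0 < l1*l2^2) (mul_pos he2 (sub_pos.2 h1))
      have := mul_nonneg (by positivity : 0 ≤ l1^2*l2) (mul_nonneg he1.le (sub_nonneg.2 h2))
      positivity
    · have h2 : x2 < e2 := h2.lt_of_ne fun h2 => hne (by rw [h1, h2, sub_self, sub_self])
      have := mul_pos (by positivity : 0 < l1^2*l2) (mul_pos he1 (sub_pos.2 h2))
      rw [h1, sub_self, mul_zero, mul_zero, add_zero]
      exact this.ne'
  · ext i
    fin_cases i <;> simp [bodyBr, rotGen, hu', hv', hu0, hv0]
    rw [eq_div_iff (by positivity)]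
    linear_combination 2 * (x1*l1 + x2*l2) * hyt + 2 * (x1*l1 + e2*l2) * hys
      + 2 * (e1*l1 + e2*l2)
        * (s * div_mul_cancel₀ (-(x1*l1 + e2*l2) * y' + (1/2)*x1*l1*l2 * t') hx.ne'
          - s' * div_mul_cancel₀ (-(x1*l1 + e2*l2) * y + (1/2)*x1*l1*l2 * t) hx.ne')

end Columns

theorem bodyBr_combination_left {u v y : ℝ → Fin 4 → ℝ} {f h : ℝ → ℝ} {a : ℝ}
    (hu : DifferentiableAt ℝ u a) (hv : DifferentiableAt ℝ v a) (hf : DifferentiableAt ℝ f a)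
    (hh : DifferentiableAt ℝ h a) :
    bodyBr (f • v + h • u) y a = f a • bodyBr v y a + h a • bodyBr u y a
      - (y a 3 * deriv f a) • v a - (y a 3 * deriv h a) • u a := by
  rw [bodyBr_comm, bodyBr_add_right y (hf.smul hv) (hh.smul hu), bodyBr_smul_right y hf hv,
    bodyBr_smul_right y hh hu, bodyBr_comm y v, bodyBr_comm y u]
  module

theorem Rtil_mulVec_Rtil_neg (th : ℝ) (x : Fin 4 → ℝ) :
    (Rtil th).mulVec ((Rtil (-th)).mulVec x) = x := by
  ext i
  fin_cases i <;> simp [Rtil, Matrix.mulVec, dotProduct, Fin.sum_univ_four]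
  · linear_combination x 0 * Real.sin_sq_add_cos_sq th
  · linear_combination x 1 * Real.sin_sq_add_cos_sq th

theorem span_of_det_ne_zero {S : Submodule ℝ (Fin 4 → ℝ)} {b : Fin 4 → Fin 4 → ℝ}
    (hdet : (Matrix.of b).det ≠ 0) (hb : ∀ i, b i ∈ S) : S = ⊤ := by
  have hli : LinearIndependent ℝ b := Matrix.linearIndependent_rows_of_det_ne_zero hdet
  rw [eq_top_iff, ← hli.span_eq_top_of_card_eq_finrank (by simp), Submodule.span_le]
  rintro _ ⟨i, rfl⟩
  exact hb i

theorem det_of_last_combination (a b c x y : Fin 4 → ℝ) (r s : ℝ) :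
    (Matrix.of ![a, b, c, r • x + s • y]).det
      = r * (Matrix.of ![a, b, c, x]).det + s * (Matrix.of ![a, b, c, y]).det := by
  have h : ∀ x, Matrix.of ![a, b, c, x] = (Matrix.of ![a, b, c, 0]).updateRow 3 x := fun x => by
    ext i j
    fin_cases i <;> simp [Matrix.updateRow_apply]
  rw [h, h x, h y, Matrix.det_updateRow_add, Matrix.det_updateRow_smul, Matrix.det_updateRow_smul]

theorem span_lieBr_eq_top {u v : ℝ → Fin 4 → ℝ} {f h s p q : ℝ → ℝ} {z : Fin 4 → ℝ}
    (hu : AnalyticAt ℝ u (z 3)) (hv : AnalyticAt ℝ v (z 3)) (hf : AnalyticAt ℝ f (z 3))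
    (hh : AnalyticAt ℝ h (z 3)) (hs : AnalyticAt ℝ s (z 3))
    (hf0 : f (z 3) ≠ 0) (hs0 : s (z 3) ≠ 0) (hq0 : q (z 3) ≠ 0)
    (hdet : (Matrix.of ![u (z 3), v (z 3), bodyBr u v (z 3),
      f (z 3) • bodyBr v (bodyBr u v) (z 3) + h (z 3) • bodyBr u (bodyBr u v) (z 3)]).det ≠ 0)
    {S : Submodule ℝ (Fin 4 → ℝ)} (h1 : bodyLift (s • u) z ∈ S)
    (h2 : bodyLift (p • u + q • v) z ∈ S)
    (h3 : lieBr (bodyLift (f • v + h • u)) (bodyLift (s • u)) z ∈ S)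
    (h4 : lieBr (bodyLift (f • v + h • u))
      (lieBr (bodyLift (f • v + h • u)) (bodyLift (s • u))) z ∈ S) : S = ⊤ := by
  set g := f • v + h • u with hg_def
  have hg : AnalyticAt ℝ g (z 3) := (hf.smul hv).add (hh.smul hu)
  set w := bodyBr u v with hw_def
  have hw : AnalyticAt ℝ w (z 3) := analyticAt_bodyBr hu hv
  set A : ℝ → ℝ := fun t => g t 3 * deriv s t - s t * (u t 3 * deriv h t)
  set B : ℝ → ℝ := fun t => -(s t * (u t 3 * deriv f t))
  set C : ℝ → ℝ := fun t => -(s t * f t)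
  have hA : AnalyticAt ℝ A (z 3) := ((analyticAt_pi_iff.1 hg 3).mul hs.deriv).sub
    (hs.mul ((analyticAt_pi_iff.1 hu 3).mul hh.deriv))
  have hB : AnalyticAt ℝ B (z 3) := (hs.mul ((analyticAt_pi_iff.1 hu 3).mul hf.deriv)).neg
  have hC : AnalyticAt ℝ C (z 3) := (hs.mul hf).neg
  have hbr : ∀ᶠ t in nhds (z 3), bodyBr g (s • u) t = (A • u + B • v + C • w) t := by
    filter_upwards [hu.eventually_analyticAt, hv.eventually_analyticAt, hf.eventually_analyticAt,
      hh.eventually_analyticAt, hs.eventually_analyticAt] with t hu hv hf hh hs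
    rw [bodyBr_smul_right g hs.differentiableAt hu.differentiableAt, hg_def,
      bodyBr_combination_left hu.differentiableAt hv.differentiableAt hf.differentiableAt
        hh.differentiableAt, bodyBr_self, bodyBr_comm v u]
    simp only [Pi.add_apply, Pi.smul_apply', A, B, C, hg_def, hw_def]
    module
  have hlie : lieBr (bodyLift g) (bodyLift (s • u)) =ᶠ[nhds z]
      bodyLift (A • u + B • v + C • w) := by
    have hcont : Filter.Tendsto (fun y : Fin 4 → ℝ => y 3) (nhds z) (nhds (z 3)) :=
      (continuous_apply 3).continuousAt
    filter_upwards [hcont.eventually hbr, hcont.eventually hg.eventually_analyticAt,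
      hcont.eventually (hs.smul hu).eventually_analyticAt] with y hy hgy hsy
    rw [lieBr_bodyLift hgy.differentiableAt hsy.differentiableAt, bodyLift, hy, bodyLift]
  have hAu := hA.differentiableAt.smul hu.differentiableAt
  have hBv := hB.differentiableAt.smul hv.differentiableAt
  have hCw := hC.differentiableAt.smul hw.differentiableAt
  rw [lieBr_congr_right hlie, lieBr_bodyLift hg.differentiableAt ((hAu.add hBv).add hCw)] at h4
  rw [hlie.eq_of_nhds] at h3
  set T := S.comap (Matrix.mulVecLin (Rtil (z 2)))
  have mem_T : ∀ y : ℝ → Fin 4 → ℝ, bodyLift y z ∈ S → y (z 3) ∈ T := fun y hy => hy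
  have hTu : u (z 3) ∈ T := (T.smul_mem_iff hs0).1 (mem_T _ h1)
  have hTv : v (z 3) ∈ T := by
    refine (T.smul_mem_iff hq0).1 ?_
    exact (T.add_mem_iff_right (T.smul_mem (p (z 3)) hTu)).1 (mem_T _ h2)
  have hTw : w (z 3) ∈ T := by
    refine (T.smul_mem_iff (neg_ne_zero.2 (mul_ne_zero hs0 hf0))).1 ?_
    exact (T.add_mem_iff_right (T.add_mem (T.smul_mem (A (z 3)) hTu)
      (T.smul_mem (B (z 3)) hTv))).1 (mem_T _ h3)
  have hleft := fun y => bodyBr_combination_left (y := y) hu.differentiableAt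
    hv.differentiableAt hf.differentiableAt hh.differentiableAt
  have hTgu : bodyBr g u (z 3) ∈ T := by
    rw [hleft, bodyBr_self, bodyBr_comm v u]
    exact T.sub_mem (T.sub_mem (T.add_mem (T.smul_mem _ (T.neg_mem hTw))
      (T.smul_mem _ T.zero_mem)) (T.smul_mem _ hTv)) (T.smul_mem _ hTu)
  have hTgv : bodyBr g v (z 3) ∈ T := by
    rw [hleft, bodyBr_self]
    exact T.sub_mem (T.sub_mem (T.add_mem (T.smul_mem _ T.zero_mem)
      (T.smul_mem _ hTw)) (T.smul_mem _ hTv)) (T.smul_mem _ hTu)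
  have hTgw : bodyBr g w (z 3) ∈ T := by
    have h4 := mem_T _ h4
    rw [bodyBr_add_right g (hAu.add hBv) hCw, bodyBr_add_right g hAu hBv,
      bodyBr_smul_right g hA.differentiableAt hu.differentiableAt,
      bodyBr_smul_right g hB.differentiableAt hv.differentiableAt,
      bodyBr_smul_right g hC.differentiableAt hw.differentiableAt,
      T.add_mem_iff_right (T.add_mem (T.add_mem (T.smul_mem _ hTgu) (T.smul_mem _ hTu))
        (T.add_mem (T.smul_mem _ hTgv) (T.smul_mem _ hTv))),
      T.add_mem_iff_left (T.smul_mem _ hTw)] at h4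
    exact (T.smul_mem_iff (neg_ne_zero.2 (mul_ne_zero hs0 hf0))).1 h4
  rw [hleft, T.sub_mem_iff_left (T.smul_mem _ hTu), T.sub_mem_iff_left (T.smul_mem _ hTv)]
    at hTgw
  have hT : T = ⊤ := by
    refine span_of_det_ne_zero hdet fun i => ?_
    fin_cases i
    exacts [hTu, hTv, hTw, hTgw]
  rw [eq_top_iff]
  intro x _
  rw [← Rtil_mulVec_Rtil_neg (z 2) x]
  exact (hT ▸ Submodule.mem_top : (Rtil (-z 2)).mulVec x ∈ T)

theorem AnalyticAt.eventually_eq_zero_of_mul {f g : ℝ → ℝ} {a : ℝ} (hf : AnalyticAt ℝ f a)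
    (hg : AnalyticAt ℝ g a) (hf0 : ¬∀ᶠ t in nhds a, f t = 0)
    (h : ∀ᶠ t in nhds a, f t * g t = 0) : ∀ᶠ t in nhds a, g t = 0 := by
  have hf0 := hf.eventually_eq_zero_or_eventually_ne_zero.resolve_left hf0
  refine hg.eventually_eq_zero_or_eventually_ne_zero.resolve_right fun hg0 => ?_
  obtain ⟨t, ht, hft, hgt⟩ := ((h.filter_mono nhdsWithin_le_nhds).and (hf0.and hg0)).exists
  exact mul_ne_zero hft hgt ht

theorem not_eventually_mul_cos_add_eq_zero {M1 : ℝ} (hM1 : M1 ≠ 0) (M2 : ℝ) :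
    ¬∀ᶠ t in nhds (0 : ℝ), M1 * Real.cos t + M2 = 0 := by
  intro h
  have h1 : deriv (fun t => M1 * Real.cos t + M2) =ᶠ[nhds 0] deriv fun _ => (0 : ℝ) :=
    Filter.EventuallyEq.deriv h
  have h2 := h1.deriv.eq_of_nhds
  simp [hM1] at h2

theorem analyticAt_mul_cos_add (M1 M2 a : ℝ) : AnalyticAt ℝ (fun t => M1 * Real.cos t + M2) a :=
  (analyticAt_const.mul Real.analyticAt_cos).add analyticAt_const

theorem exists_eventually_combination_ne_zero {d e : ℝ → ℝ} {k M1 M2 : ℝ} (hd : AnalyticAt ℝ d 0)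
    (he : AnalyticAt ℝ e 0) (hde : d 0 ≠ 0 ∨ e 0 ≠ 0) (hk : k ≠ 0) (hM1 : M1 ≠ 0) {b : ℝ}
    (hb : 0 < b) :
    ∃ c, 0 < c ∧ c ≤ b ∧ ∀ᶠ t in nhdsWithin (0 : ℝ) {0}ᶜ,
      (k * t - c * M2) * e t + -(c * (M1 * Real.cos t + M2)) * d t ≠ 0 := by
  have han : ∀ c, AnalyticAt ℝ
      (fun t => (k * t - c * M2) * e t + -(c * (M1 * Real.cos t + M2)) * d t) 0 := fun c =>
    ((((analyticAt_const.mul analyticAt_id).sub analyticAt_const).mul he).add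
      ((analyticAt_const.mul (analyticAt_mul_cos_add M1 M2 0)).neg.mul hd))
  by_contra! hne
  have hz1 := (han b).eventually_eq_zero_or_eventually_ne_zero.resolve_right
    (hne b hb le_rfl)
  have hz2 := (han (b / 2)).eventually_eq_zero_or_eventually_ne_zero.resolve_right
    (hne (b / 2) (half_pos hb) (half_le_self hb.le))
  have hid : ¬∀ᶠ t in nhds (0 : ℝ), t = 0 := fun h => by
    have h1 : deriv (fun t : ℝ => t) =ᶠ[nhds 0] deriv fun _ => (0 : ℝ) :=
      Filter.EventuallyEq.deriv h
    simpa using h1.eq_of_nhds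
  have he0 : ∀ᶠ t in nhds (0 : ℝ), e t = 0 := by
    refine analyticAt_id.eventually_eq_zero_of_mul he hid ?_
    filter_upwards [hz1, hz2] with t h1 h2
    have : k * (t * e t) = 0 := by linear_combination 2 * h2 - h1
    exact (mul_eq_zero.1 this).resolve_left hk
  have hd0 : ∀ᶠ t in nhds (0 : ℝ), d t = 0 := by
    refine (analyticAt_mul_cos_add M1 M2 0).eventually_eq_zero_of_mul hd
      (not_eventually_mul_cos_add_eq_zero hM1 M2) ?_
    filter_upwards [hz1, he0] with t h1 h2
    have : b * ((M1 * Real.cos t + M2) * d t) = 0 := by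
      linear_combination -h1 + (k * t - b * M2) * h2
    exact (mul_eq_zero.1 this).resolve_left hb.ne'
  exact hde.elim (fun h => h hd0.self_of_nhds) fun h => h he0.self_of_nhds

theorem det_bodyBr_ne_zero {u v : ℝ → Fin 4 → ℝ} {a P : ℝ} (hP : P ≠ 0)
    (hm : u a 2 * v a 3 - v a 2 * u a 3 ≠ 0) (hw : bodyBr u v a = ![P, 0, 0, 0]) :
    (Matrix.of ![u a, v a, bodyBr u v a, bodyBr u (bodyBr u v) a]).det ≠ 0 ∨
      (Matrix.of ![u a, v a, bodyBr u v a, bodyBr v (bodyBr u v) a]).det ≠ 0 := by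
  generalize bodyBr u v = w at hw ⊢
  by_contra! h
  have hcomb := det_of_last_combination (u a) (v a) (w a) (bodyBr u w a)
    (bodyBr v w a) (v a 3) (-u a 3)
  have hlast : v a 3 • bodyBr u w a + (-u a 3) • bodyBr v w a
      = ![0, (u a 2 * v a 3 - v a 2 * u a 3) * P, 0, 0] := by
    rw [bodyBr, bodyBr, hw]
    ext i
    fin_cases i <;> simp [rotGen, Matrix.vecHead, Matrix.vecTail] <;> ring
  rw [h.1, h.2, hlast, hw] at hcomb
  have hval : (Matrix.of ![u a, v a, ![P, 0, 0, 0],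
      ![0, (u a 2 * v a 3 - v a 2 * u a 3) * P, 0, 0]]).det
      = (u a 2 * v a 3 - v a 2 * u a 3) ^ 2 * P ^ 2 := by
    simp [Matrix.det_succ_row_zero, Fin.sum_univ_succ, Fin.succAbove]
    ring
  rw [hval, mul_zero, mul_zero, add_zero] at hcomb
  exact mul_ne_zero (pow_ne_zero 2 hm) (pow_ne_zero 2 hP) hcomb

/-- claim (21) of the paper: span of the columns of B_j along
the reference trajectory. -/
theorem stmt_16 (l1 l2 x1 x2 e1 e2 k M1 M2 : ℝ)
    (hl1 : 0 < l1) (hl2 : 0 < l2) (hx1 : 0 < x1) (hx2 : 0 < x2)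
    (he1 : 0 < e1) (he2 : 0 < e2) (hk : 0 < k)
    (hA : AssumptionA l1 l2 x1 x2 e1 e2 M1 M2) :
    ∀ β : ℝ, 0 < β → ∃ βs : ℝ, 0 < βs ∧ βs ≤ β ∧ ∃ ab : ℝ, 0 < ab ∧
      ∀ z : Fin 4 → ℝ, 0 < |z 3| → |z 3| < ab →
        (let G : (Fin 4 → ℝ) → (Fin 4 → ℝ) :=
          fun u => F0 l1 l2 x1 x2 e1 e2 k u + βs • F2 l1 l2 x1 x2 e1 e2 M1 M2 u
        let C10 := F1 l1 l2 x1 x2 e1 e2 M1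
        let C20 := F2 l1 l2 x1 x2 e1 e2 M1 M2
        Submodule.span ℝ
          ({C10 z, C20 z, lieBr G C10 z, lieBr G C20 z,
            lieBr G (lieBr G C10) z, lieBr G (lieBr G C20) z} :
            Set (Fin 4 → ℝ)) = ⊤) := by
  obtain ⟨hne, h1, h2, hM1, hM2, -⟩ := hA
  intro β hβ
  set u : ℝ → Fin 4 → ℝ := fun a i => (Emat l1 l2 x1 x2 e1 e2 a)⁻¹ i 2
  set v : ℝ → Fin 4 → ℝ := fun a i => (Emat l1 l2 x1 x2 e1 e2 a)⁻¹ i 3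
  have hdet : (Emat l1 l2 x1 x2 e1 e2 0).det ≠ 0 := by
    rw [det_Emat_zero, neg_mul, neg_div]
    exact neg_ne_zero.2 (by positivity)
  have hinv := analyticAt_inv_apply (analyticAt_Emat l1 l2 x1 x2 e1 e2 0) hdet
  have hu : AnalyticAt ℝ u 0 := analyticAt_pi_iff.2 fun i => hinv i 2
  have hv : AnalyticAt ℝ v 0 := analyticAt_pi_iff.2 fun i => hinv i 3
  have hE : ∀ᶠ t in nhds 0,
      Emat l1 l2 x1 x2 e1 e2 t * (Emat l1 l2 x1 x2 e1 e2 t)⁻¹ = 1 := by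
    filter_upwards [(analyticAt_det
      (analyticAt_Emat l1 l2 x1 x2 e1 e2 0)).continuousAt.eventually_ne hdet] with t ht
    exact Matrix.mul_nonsing_inv _ (isUnit_iff_ne_zero.2 ht)
  have hEu : ∀ᶠ t in nhds 0, (Emat l1 l2 x1 x2 e1 e2 t).mulVec (u t) = ![0, 0, 1, 0] :=
    hE.mono fun t ht => by
      ext i
      refine (congrFun (congrFun ht i) 2).trans ?_
      fin_cases i <;> rfl
  have hEv : ∀ᶠ t in nhds 0, (Emat l1 l2 x1 x2 e1 e2 t).mulVec (v t) = ![0, 0, 0, 1] :=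
    hE.mono fun t ht => by
      ext i
      refine (congrFun (congrFun ht i) 3).trans ?_
      fin_cases i <;> rfl
  obtain ⟨hm, P, hP, hw0⟩ := frame_nondegenerate hl1 hl2 hx1 hx2 he1 he2 hne h1 h2
    hu.differentiableAt hv.differentiableAt hEu hEv
  have hw := analyticAt_bodyBr hu hv
  have hdet_an : ∀ {y : ℝ → Fin 4 → ℝ}, AnalyticAt ℝ y 0 →
      AnalyticAt ℝ (fun t => (Matrix.of ![u t, v t, bodyBr u v t, y t]).det) 0 := fun {y} hy =>
    analyticAt_det fun i j => by
      fin_cases i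
      exacts [analyticAt_pi_iff.1 hu j, analyticAt_pi_iff.1 hv j, analyticAt_pi_iff.1 hw j,
        analyticAt_pi_iff.1 hy j]
  obtain ⟨c, hc, hcβ, hne0⟩ := exists_eventually_combination_ne_zero (M2 := M2)
    (hdet_an (analyticAt_bodyBr hu hw)) (hdet_an (analyticAt_bodyBr hv hw))
    (det_bodyBr_ne_zero hP hm hw0) hk.ne' hM1 hβ
  refine ⟨c, hc, hcβ, ?_⟩
  have hf0 : ∀ᶠ t in nhds (0 : ℝ), k * t - c * M2 ≠ 0 := by
    refine ContinuousAt.eventually_ne (by fun_prop) ?_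
    simp [hc.ne', hM2]
  have hev := ((hu.eventually_analyticAt.and hv.eventually_analyticAt).and hf0).and
    (eventually_nhdsWithin_iff.1 hne0)
  obtain ⟨ε, hε, hball⟩ := Metric.eventually_nhds_iff.1 hev
  refine ⟨min ε Real.pi, lt_min hε Real.pi_pos, fun z hz0 hz => ?_⟩
  obtain ⟨⟨⟨hua, hva⟩, hfa⟩, hda⟩ := @hball (z 3)
    (by rw [Real.dist_eq, sub_zero]; exact hz.trans_le (min_le_left _ _))
  have hza : z 3 ≠ 0 := abs_pos.1 hz0
  have hsin : Real.sin (z 3) ≠ 0 := by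
    have hπ := abs_lt.1 (hz.trans_le (min_le_right _ _))
    exact fun h => hza ((Real.sin_eq_zero_iff_of_lt_of_lt hπ.1 hπ.2).1 h)
  set f : ℝ → ℝ := fun t => k * t - c * M2
  set h : ℝ → ℝ := fun t => -(c * (M1 * Real.cos t + M2))
  have hF1 : F1 l1 l2 x1 x2 e1 e2 M1 = bodyLift ((fun t : ℝ => M1 * Real.sin t) • u) := by
    ext1 y
    exact (Matrix.mulVec_smul _ _ _).symm
  have hF2 : F2 l1 l2 x1 x2 e1 e2 M1 M2
      = bodyLift ((fun t : ℝ => -(M1 * Real.cos t + M2)) • u + (fun _ : ℝ => -M2) • v) := by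
    ext1 y
    simp only [F2, X3, X4, bodyLift, Pi.add_apply, Pi.smul_apply', Matrix.mulVec_add,
      Matrix.mulVec_smul, u, v]
    module
  have hG : (fun y => F0 l1 l2 x1 x2 e1 e2 k y + c • F2 l1 l2 x1 x2 e1 e2 M1 M2 y)
      = bodyLift (f • v + h • u) := by
    ext1 y
    simp only [F0, F2, X3, X4, bodyLift, Pi.add_apply, Pi.smul_apply', Matrix.mulVec_add,
      Matrix.mulVec_smul, u, v, f, h]
    module
  intro G C10 C20
  have hS := Submodule.subset_span (R := ℝ) (s := ({C10 z, C20 z, lieBr G C10 z, lieBr G C20 z,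
    lieBr G (lieBr G C10) z, lieBr G (lieBr G C20) z} : Set (Fin 4 → ℝ)))
  refine span_lieBr_eq_top (f := f) (h := h) (s := fun t => M1 * Real.sin t)
    (p := fun t => -(M1 * Real.cos t + M2)) (q := fun _ => -M2) hua hva
    ((analyticAt_const.mul analyticAt_id).sub analyticAt_const)
    (analyticAt_const.mul (analyticAt_mul_cos_add M1 M2 _)).neg
    (analyticAt_const.mul Real.analyticAt_sin) hfa (mul_ne_zero hM1 hsin) (neg_ne_zero.2 hM2)
    ?_ ?_ ?_ ?_ ?_
  · rw [det_of_last_combination]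
    exact hda hza
  · rw [← hF1]
    exact hS (.inl rfl)
  · rw [← hF2]
    exact hS (.inr (.inl rfl))
  · rw [← hF1, ← hG]
    exact hS (.inr (.inr (.inl rfl)))
  · rw [← hF1, ← hG]
    exact hS (.inr (.inr (.inr (.inr (.inl rfl)))))
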